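/- Let a > 0 and γ > 1. There exists a constant C = C(a, γ) > 0 such that for all ρ ≥ 0, c ≥ 0 and p ∈ ℝ with a ρ^γ = c + p, one has | ρ ( ρ^{γ−1} − (c/a)^{(γ−1)/γ} ) | ≤ C |p|. -/

import Mathlib

open MeasureTheory Filter
open scoped ENNReal Topology

noncomputable section

/-- ℝ³ as Euclidean space. -/
abbrev E3 : Type := EuclideanSpace ℝ (Fin 3)

/-- Partial derivative of a scalar function in the `j`-th coordinate direction. -/
def pd (f : E3 → ℝ) (j : Fin 3) (x : E3) : ℝ :=
  fderiv ℝ f x (EuclideanSpace.single j 1)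

/-- Pointwise Euclidean norm `|u(x)|` of a vector field. -/
def vecNormFun (u : E3 → Fin 3 → ℝ) (x : E3) : ℝ :=
  Real.sqrt (∑ i, u x i ^ 2)

/-- `|∇u|²(x) = Σ_{i,j} (∂_j u_i)²(x)`. -/
def gradSq (u : E3 → Fin 3 → ℝ) (x : E3) : ℝ :=
  ∑ i, ∑ j, (pd (fun y => u y i) j x) ^ 2

/-- `div u (x) = Σ_j ∂_j u_j (x)`. -/
def div3 (u : E3 → Fin 3 → ℝ) (x : E3) : ℝ :=
  ∑ j, pd (fun y => u y j) j x

/-- `(ρ, u)` is a smooth (pointwise) solution of the stationary barotropic compressible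
Navier–Stokes equations on ℝ³ with pressure `P = a ρ^γ`, shear viscosity `ν` and
bulk-related viscosity `lam`. -/
structure IsNSESolution (ν lam a γ : ℝ) (ρ : E3 → ℝ) (u : E3 → Fin 3 → ℝ) : Prop where
  hν : 0 < ν
  hlam : 0 < lam + 2 / 3 * ν
  ha : 0 < a
  hγ : 1 < γ
  hρ_smooth : ContDiff ℝ (⊤ : ℕ∞) ρ
  hρ_nonneg : ∀ x, 0 ≤ ρ x
  hu_smooth : ∀ i, ContDiff ℝ (⊤ : ℕ∞) fun x => u x i
  mass : ∀ x, ∑ i, pd (fun y => ρ y * u y i) i x = 0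
  momentum : ∀ x, ∀ i,
    ∑ j, pd (fun y => ρ y * u y i * u y j) j x
      - ν * ∑ j, pd (pd (fun y => u y i) j) j x
      - (lam + ν) * pd (fun y => div3 u y) i x
      + pd (fun y => a * ρ y ^ γ) i x = 0

/-- Lorentz quasinorm `‖f‖_{L^{p,q}(Ω)}` for `q < ∞`. -/
def lorentzNorm (f : E3 → ℝ) (Ω : Set E3) (p q : ℝ) : ℝ≥0∞ :=
  (∫⁻ t in Set.Ioi (0 : ℝ),
      ENNReal.ofReal (t ^ (q - 1)) * volume {x | x ∈ Ω ∧ t < |f x|} ^ (q / p)) ^ (1 / q)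

/-- Weak Lorentz quasinorm `‖f‖_{L^{p,∞}(Ω)}`. -/
def weakLorentzNorm (f : E3 → ℝ) (Ω : Set E3) (p : ℝ) : ℝ≥0∞ :=
  ⨆ t ∈ Set.Ioi (0 : ℝ), ENNReal.ofReal t * volume {x | x ∈ Ω ∧ t < |f x|} ^ (1 / p)

/-- The annulus `{x : R ≤ |x| ≤ 2R}`. -/
def ann (R : ℝ) : Set E3 := {x | R ≤ ‖x‖ ∧ ‖x‖ ≤ 2 * R}

/-- `M_{p,q}(R) = R^{2/3 - 3/p} ‖u‖_{L^{p,q}(R ≤ |x| ≤ 2R)}`. -/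
def Mpq (u : E3 → Fin 3 → ℝ) (p q R : ℝ) : ℝ≥0∞ :=
  ENNReal.ofReal (R ^ ((2 : ℝ) / 3 - 3 / p)) * lorentzNorm (vecNormFun u) (ann R) p q

/-- `M_{p,∞}(R) = R^{2/3 - 3/p} ‖u‖_{L^{p,∞}(R ≤ |x| ≤ 2R)}`. -/
def MpInf (u : E3 → Fin 3 → ℝ) (p R : ℝ) : ℝ≥0∞ :=
  ENNReal.ofReal (R ^ ((2 : ℝ) / 3 - 3 / p)) * weakLorentzNorm (vecNormFun u) (ann R) p

/-- Replacing one factor `y` of `y ^ γ` by `x` does not increase the distance to `x ^ γ`. -/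
theorem abs_mul_rpow_sub_one_sub_le {γ x y : ℝ} (hγ : 1 < γ) (hx : 0 ≤ x) (hy : 0 ≤ y) :
    |x * (x ^ (γ - 1) - y ^ (γ - 1))| ≤ |x ^ γ - y ^ γ| := by
  have hmul : ∀ z : ℝ, 0 ≤ z → z ^ γ = z * z ^ (γ - 1) := fun z hz => by
    rw [← Real.rpow_one_add' hz (by linarith), add_sub_cancel]
  have hγ' : 0 ≤ γ - 1 := by linarith
  have hy' : 0 ≤ y ^ (γ - 1) := Real.rpow_nonneg hy _
  rw [hmul x hx, hmul y hy]
  rcases le_total y x with h | h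
  · have hpow := Real.rpow_le_rpow hy h hγ'
    have hnonneg := mul_nonneg hx (sub_nonneg.2 hpow)
    have hle := mul_le_mul_of_nonneg_right h hy'
    rw [abs_of_nonneg hnonneg, abs_of_nonneg (by linarith)]
    linarith
  · have hpow := Real.rpow_le_rpow hx h hγ'
    have hnonpos := mul_nonpos_of_nonneg_of_nonpos hx (sub_nonpos.2 hpow)
    have hle := mul_le_mul_of_nonneg_right h hy'
    rw [abs_of_nonpos hnonpos, abs_of_nonpos (by linarith)]
    linarith

/-- Pressure estimate: for `a > 0`, `γ > 1` there is `C = C(a,γ) > 0` such that whenever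
`ρ ≥ 0`, `c ≥ 0` and `a ρ^γ = c + p`, one has
`|ρ (ρ^{γ-1} - (c/a)^{(γ-1)/γ})| ≤ C |p|`. -/
theorem pressure_estimate (a γ : ℝ) (ha : 0 < a) (hγ : 1 < γ) :
    ∃ C : ℝ, 0 < C ∧ ∀ ρ c p : ℝ, 0 ≤ ρ → 0 ≤ c → a * ρ ^ γ = c + p →
      |ρ * (ρ ^ (γ - 1) - (c / a) ^ ((γ - 1) / γ))| ≤ C * |p| := by
  refine ⟨a⁻¹, inv_pos.2 ha, fun ρ c p hρ hc h => ?_⟩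
  have hγ0 : γ ≠ 0 := by linarith
  have hca : 0 ≤ c / a := div_nonneg hc ha.le
  have key := abs_mul_rpow_sub_one_sub_le hγ hρ (Real.rpow_nonneg hca γ⁻¹)
  rw [← Real.rpow_mul hca, ← Real.rpow_mul hca, inv_mul_cancel₀ hγ0, Real.rpow_one,
    inv_mul_eq_div] at key
  have hp : ρ ^ γ - c / a = a⁻¹ * p := by
    field_simp
    linarith
  rwa [hp, abs_mul a⁻¹, abs_of_pos (inv_pos.2 ha)] at key
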